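/- For every natural number n and every real number x, the Euler polynomial admits the moment representation E_n(x) = ∫_{-∞}^{∞} (x - 1/2 + i u)^n · sech(π u) du, where the integral is an absolutely convergent complex-valued integral whose value is the real number E_n(x). -/

import Mathlib

open MeasureTheory Real

lemma aux_pow_bound (n : ℕ) (z : ℂ) : ‖z ^ n‖ ≤ n.factorial * rexp ‖z‖ := by
  rw [norm_pow]
  have h := Real.pow_div_factorial_le_exp ‖z‖ (norm_nonneg _) n
  rw [div_le_iff₀ (by positivity)] at h
  linarith

lemma aux_cosh_bound (u : ℝ) : rexp (3 * |u|) / 2 ≤ Real.cosh (π * u) := by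
  rw [← Real.cosh_abs, abs_mul, abs_of_pos Real.pi_pos, Real.cosh_eq]
  have h1 : rexp (3 * |u|) ≤ rexp (π * |u|) := by
    apply Real.exp_le_exp.2
    exact mul_le_mul_of_nonneg_right Real.pi_gt_three.le (abs_nonneg u)
  have h2 := Real.exp_pos (-(π * |u|))
  linarith

lemma aux_sinh_bound (T : ℝ) (hT : 1 ≤ T) : rexp (2 * T) / 2 ≤ Real.sinh (π * T) := by
  have h0 : Real.sinh (3 * T) ≤ Real.sinh (π * T) :=
    Real.sinh_le_sinh.2 (mul_le_mul_of_nonneg_right Real.pi_gt_three.le (by linarith))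
  refine le_trans ?_ h0
  rw [Real.sinh_eq]
  have h1 : rexp (3 * T) = rexp (2 * T) * rexp T := by rw [← Real.exp_add]; ring_nf
  have h2 : 1 + T ≤ rexp T := by linarith [Real.add_one_le_exp T]
  have h3 : 1 ≤ rexp (2 * T) := Real.one_le_exp (by linarith)
  have h4 : rexp (-(3 * T)) ≤ 1 := Real.exp_le_one_iff.2 (by linarith)
  nlinarith

lemma aux_integrable (n : ℕ) (a : ℂ) : Integrable (fun u : ℝ =>
      (a + Complex.I * (u : ℂ)) ^ n * ((1 / Real.cosh (π * u) : ℝ) : ℂ)) := by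
  refine Integrable.mono' (g := fun u : ℝ => (2 * n.factorial * rexp ‖a‖) * (1 + u ^ 2)⁻¹)
    (integrable_inv_one_add_sq.const_mul _) ?_ ?_
  · apply Continuous.aestronglyMeasurable
    have : ∀ u : ℝ, Real.cosh (π * u) ≠ 0 := fun u => (Real.cosh_pos _).ne'
    have h : Continuous (fun u : ℝ => 1 / Real.cosh (π * u)) := by
      refine Continuous.div continuous_const ?_ this
      exact Real.continuous_cosh.comp (by fun_prop)
    have h2 : Continuous (fun u : ℝ => ((1 / Real.cosh (π * u) : ℝ) : ℂ)) :=
      Complex.continuous_ofReal.comp h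
    refine Continuous.mul (by fun_prop) h2
  · refine Filter.Eventually.of_forall fun u => ?_
    rw [norm_mul]
    have h1 := aux_pow_bound n (a + Complex.I * (u : ℂ))
    have h2 : ‖a + Complex.I * (u : ℂ)‖ ≤ ‖a‖ + |u| := by
      refine (norm_add_le _ _).trans ?_
      simp
    have h3 : rexp ‖a + Complex.I * (u : ℂ)‖ ≤ rexp ‖a‖ * rexp |u| := by
      rw [← Real.exp_add]; exact Real.exp_le_exp.2 h2
    have h4 := aux_cosh_bound u
    have h5 : 1 + u ^ 2 ≤ rexp (2 * |u|) := by
      have := Real.quadratic_le_exp_of_nonneg (x := 2 * |u|) (by positivity)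
      have h6 := sq_abs u
      nlinarith [abs_nonneg u, sq_nonneg u]
    have h7 : rexp (3 * |u|) = rexp (2 * |u|) * rexp |u| := by
      rw [← Real.exp_add]; ring_nf
    have hc := Real.cosh_pos (π * u)
    rw [Complex.norm_real, Real.norm_of_nonneg (by positivity)]
    have h8 : 1 / Real.cosh (π * u) ≤ 2 * (1 + u ^ 2)⁻¹ * (rexp |u|)⁻¹ := by
      rw [div_le_iff₀ hc]
      have h9 : (1 + u ^ 2) * rexp |u| ≤ 2 * Real.cosh (π * u) := by
        have := mul_le_mul_of_nonneg_right h5 (Real.exp_pos |u|).le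
        linarith
      have h10 : 0 < (1 + u ^ 2) * rexp |u| := by positivity
      calc (1:ℝ) = ((1 + u ^ 2) * rexp |u|) * ((1 + u ^ 2) * rexp |u|)⁻¹ := by
            field_simp
        _ ≤ (2 * Real.cosh (π * u)) * ((1 + u ^ 2) * rexp |u|)⁻¹ := by gcongr
        _ = _ := by rw [mul_inv]; ring
    calc _ ≤ (n.factorial * (rexp ‖a‖ * rexp |u|)) * (2 * (1 + u ^ 2)⁻¹ * (rexp |u|)⁻¹) := by
          gcongr
          exact h1.trans (by gcongr)
      _ = _ := by
          field_simp

lemma aux_sech : ∫ u : ℝ, ((1 / Real.cosh (π * u) : ℝ) : ℂ) = 1 := by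
  have hi : Integrable (fun u : ℝ => ((1 / Real.cosh (π * u) : ℝ) : ℂ)) := by
    simpa using aux_integrable 0 0
  have hi' : Integrable (fun u : ℝ => 1 / Real.cosh (π * u)) := by
    have := hi.re
    simpa only [RCLike.re_to_complex, Complex.ofReal_re] using this
  rw [integral_complex_ofReal]
  have hd : ∀ u : ℝ, HasDerivAt (fun u : ℝ => Real.arctan (Real.sinh (π * u)) / π)
      (1 / Real.cosh (π * u)) u := by
    intro u
    have h := (((Real.hasDerivAt_sinh (π * u)).comp u
      ((hasDerivAt_id u).const_mul π)).arctan).div_const π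
    refine h.congr_deriv ?_
    have hc := Real.cosh_pos (π * u)
    have := Real.cosh_sq (π * u)
    have e : 1 + ((Real.sinh ∘ HMul.hMul π) u) ^ 2 = Real.cosh (π * u) ^ 2 := by
      simp; linarith
    rw [e]
    field_simp
  have ht : Filter.Tendsto (fun u : ℝ => Real.sinh (π * u)) Filter.atTop Filter.atTop := by
    refine Filter.tendsto_atTop_mono' _ ?_ Filter.tendsto_id
    filter_upwards [Filter.eventually_ge_atTop 0] with u hu
    have h1 : π * u ≤ Real.sinh (π * u) := Real.self_le_sinh_iff.2 (by positivity)
    simp only [id]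
    nlinarith [Real.pi_gt_three]
  have h1 : Filter.Tendsto (fun u : ℝ => Real.arctan (Real.sinh (π * u)) / π) Filter.atTop
      (nhds ((π / 2) / π)) :=
    (((Real.tendsto_arctan_atTop).mono_right nhdsWithin_le_nhds).comp ht).div_const π
  have h2 : Filter.Tendsto (fun u : ℝ => Real.arctan (Real.sinh (π * u)) / π) Filter.atBot
      (nhds (-((π / 2) / π))) := by
    have := (h1.comp Filter.tendsto_neg_atBot_atTop).neg
    refine this.congr fun u => ?_
    simp [neg_div]
  rw [integral_of_hasDerivAt_of_tendsto hd hi' h2 h1]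
  have : (π:ℝ) ≠ 0 := Real.pi_ne_zero
  have e : (π / 2) / π - -((π / 2) / π) = 1 := by field_simp; norm_num
  rw [e]; simp

lemma aux_norm_sin (z : ℂ) : |Real.sinh z.im| ≤ ‖Complex.sin z‖ := by
  have h := abs_norm_sub_norm_le (Complex.exp (-z * Complex.I)) (Complex.exp (z * Complex.I))
  rw [Complex.norm_exp, Complex.norm_exp] at h
  simp only [Complex.mul_I_re, Complex.neg_im, neg_neg] at h
  rw [Complex.sin, Real.sinh_eq, norm_div, norm_mul, Complex.norm_I, abs_div]
  simp only [mul_one, Complex.norm_ofNat, abs_two]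
  gcongr

/-- The holomorphic function used in the contour argument. -/
noncomputable def auxG (n : ℕ) (x : ℂ) (w : ℂ) : ℂ :=
  dslope (fun w => (x + w) ^ n) 0 w / dslope (fun w => Complex.sin (π * w)) 0 w

lemma auxG_eq (n : ℕ) (x w : ℂ) (hw : w ≠ 0) :
    auxG n x w = ((x + w) ^ n - x ^ n) / Complex.sin (π * w) := by
  unfold auxG
  rw [dslope_of_ne _ hw, dslope_of_ne _ hw, slope_def_field, slope_def_field]
  simp only [add_zero, mul_zero, Complex.sin_zero, sub_zero]
  rw [div_div_div_cancel_right₀ hw]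

lemma auxG_diff (n : ℕ) (x : ℂ) : DifferentiableOn ℂ (auxG n x) {w | |w.re| ≤ 1 / 2} := by
  have h1 : DifferentiableOn ℂ (dslope (fun w : ℂ => (x + w) ^ n) 0) Set.univ :=
    (Complex.differentiableOn_dslope Filter.univ_mem).2 (by fun_prop)
  have h2 : DifferentiableOn ℂ (dslope (fun w : ℂ => Complex.sin (π * w)) 0) Set.univ :=
    (Complex.differentiableOn_dslope Filter.univ_mem).2 (by
      have : Differentiable ℂ (fun w : ℂ => Complex.sin (π * w)) :=
        Complex.differentiable_sin.comp (by fun_prop)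
      exact this.differentiableOn)
  refine (h1.mono (Set.subset_univ _)).div (h2.mono (Set.subset_univ _)) ?_
  intro w hw
  have hpi : (π : ℂ) ≠ 0 := by exact_mod_cast Real.pi_ne_zero
  by_cases h0 : w = 0
  · subst h0
    rw [dslope_same]
    have : HasDerivAt (fun w : ℂ => Complex.sin (π * w)) (Complex.cos (π * 0) * (π * 1)) 0 :=
      ((hasDerivAt_id (0 : ℂ)).const_mul (π : ℂ)).csin
    rw [this.deriv]
    simp
  · rw [dslope_of_ne _ h0, slope_def_field]
    simp only [mul_zero, Complex.sin_zero, sub_zero]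
    refine div_ne_zero ?_ h0
    intro hs
    obtain ⟨k, hk⟩ := Complex.sin_eq_zero_iff.1 hs
    have hwk : w = k := by
      rw [mul_comm] at hk
      exact mul_right_cancel₀ hpi hk
    subst hwk
    simp only [Set.mem_ofPred_eq, Complex.intCast_re] at hw
    have hk1 : |k| < 1 := by
      have : (|k| : ℝ) < 1 := by linarith
      exact_mod_cast this
    rw [Int.abs_lt_one_iff] at hk1
    exact h0 (by simp [hk1])

lemma auxG_bound (n : ℕ) (x : ℂ) (s T : ℝ) (hs : |s| ≤ 1 / 2) (hT : 1 ≤ |T|) :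
    ‖auxG n x (s + T * Complex.I)‖ ≤ (4 * n.factorial * rexp (‖x‖ + 1)) * rexp (-|T|) := by
  have hw : (s + T * Complex.I : ℂ) ≠ 0 := by
    intro h
    have := congrArg Complex.im h
    simp at this
    subst this
    norm_num at hT
  rw [auxG_eq _ _ _ hw, norm_div]
  have h1 : rexp (2 * |T|) / 2 ≤ ‖Complex.sin (π * (s + T * Complex.I))‖ := by
    refine le_trans ?_ (aux_norm_sin _)
    have : (π * (s + T * Complex.I) : ℂ).im = π * T := by simp
    rw [this, Real.abs_sinh, abs_mul, abs_of_pos Real.pi_pos]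
    exact aux_sinh_bound _ hT
  have h2 : ‖x + (s + T * Complex.I)‖ ≤ ‖x‖ + 1 + |T| := by
    have a1 := norm_add_le x (s + T * Complex.I)
    have a2 := norm_add_le (s : ℂ) (T * Complex.I)
    simp only [norm_mul, Complex.norm_real, Complex.norm_I, Real.norm_eq_abs, mul_one] at a2
    linarith
  have h3 : ‖(x + (s + T * Complex.I)) ^ n - x ^ n‖ ≤
      2 * n.factorial * rexp (‖x‖ + 1 + |T|) := by
    have b1 := aux_pow_bound n (x + (s + T * Complex.I))
    have b2 := aux_pow_bound n x
    have b3 : (n.factorial : ℝ) * rexp ‖x + (s + T * Complex.I)‖ ≤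
      n.factorial * rexp (‖x‖ + 1 + |T|) := by gcongr
    have b4 : (n.factorial : ℝ) * rexp ‖x‖ ≤ n.factorial * rexp (‖x‖ + 1 + |T|) := by
      gcongr; linarith
    have := norm_sub_le ((x + (s + T * Complex.I)) ^ n) (x ^ n)
    linarith
  calc _ ≤ (2 * n.factorial * rexp (‖x‖ + 1 + |T|)) / (rexp (2 * |T|) / 2) := by gcongr
    _ = _ := by
      have : rexp (-|T|) = rexp |T| / rexp (2 * |T|) := by
        rw [← Real.exp_sub]; ring_nf
      rw [this, Real.exp_add (‖x‖ + 1)]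
      field_simp
      ring

lemma auxG_right (n : ℕ) (x : ℂ) (u : ℝ) : auxG n x (1 / 2 + u * Complex.I) =
    ((x + 1 / 2 + Complex.I * u) ^ n - x ^ n) * ((1 / Real.cosh (π * u) : ℝ) : ℂ) := by
  have hw : (1 / 2 + u * Complex.I : ℂ) ≠ 0 := by
    intro h
    have := congrArg Complex.re h
    simp at this
  rw [auxG_eq _ _ _ hw]
  have : Complex.sin (π * (1 / 2 + u * Complex.I)) = Real.cosh (π * u) := by
    rw [show (π * (1 / 2 + u * Complex.I) : ℂ) = (π * u : ℂ) * Complex.I + π / 2 by ring,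
      Complex.sin_add_pi_div_two, Complex.cos_mul_I]
    push_cast; rfl
  rw [this]
  push_cast
  ring_nf

lemma auxG_left (n : ℕ) (x : ℂ) (u : ℝ) : auxG n x (-(1 / 2) + u * Complex.I) =
    -(((x - 1 / 2 + Complex.I * u) ^ n - x ^ n) * ((1 / Real.cosh (π * u) : ℝ) : ℂ)) := by
  have hw : (-(1 / 2) + u * Complex.I : ℂ) ≠ 0 := by
    intro h
    have := congrArg Complex.re h
    simp at this
  rw [auxG_eq _ _ _ hw]
  have : Complex.sin (π * (-(1 / 2) + u * Complex.I)) = -Real.cosh (π * u) := by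
    rw [show (π * (-(1 / 2) + u * Complex.I) : ℂ) = (π * u : ℂ) * Complex.I - π / 2 by ring,
      Complex.sin_sub_pi_div_two, Complex.cos_mul_I]
    push_cast; rfl
  rw [this]
  push_cast
  rw [div_neg]
  ring_nf

lemma aux_key (n : ℕ) (x : ℂ) :
    (∫ u : ℝ, (x + 1 / 2 + Complex.I * u) ^ n * ((1 / Real.cosh (π * u) : ℝ) : ℂ)) +
    (∫ u : ℝ, (x - 1 / 2 + Complex.I * u) ^ n * ((1 / Real.cosh (π * u) : ℝ) : ℂ)) =
    2 * x ^ n := by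
  have i1 := aux_integrable n (x + 1 / 2)
  have i2 := aux_integrable n (x - 1 / 2)
  have i0 : Integrable (fun u : ℝ => ((1 / Real.cosh (π * u) : ℝ) : ℂ)) := by
    simpa using aux_integrable 0 0
  have i0' := i0.const_mul (x ^ n)
  have e1 : (fun u : ℝ => auxG n x (1 / 2 + u * Complex.I)) = fun u : ℝ =>
      (x + 1 / 2 + Complex.I * u) ^ n * ((1 / Real.cosh (π * u) : ℝ) : ℂ) -
        x ^ n * ((1 / Real.cosh (π * u) : ℝ) : ℂ) := by
    ext u; rw [auxG_right]; ring
  have e2 : (fun u : ℝ => auxG n x (-(1 / 2) + u * Complex.I)) = fun u : ℝ =>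
      -((x - 1 / 2 + Complex.I * u) ^ n * ((1 / Real.cosh (π * u) : ℝ) : ℂ) -
        x ^ n * ((1 / Real.cosh (π * u) : ℝ) : ℂ)) := by
    ext u; rw [auxG_left]; ring
  have j1 : Integrable (fun u : ℝ => auxG n x (1 / 2 + u * Complex.I)) := by
    rw [e1]; exact i1.sub i0'
  have j2 : Integrable (fun u : ℝ => auxG n x (-(1 / 2) + u * Complex.I)) := by
    rw [e2]; exact (i2.sub i0').neg
  have v1 : ∫ u : ℝ, auxG n x (1 / 2 + u * Complex.I) =
      (∫ u : ℝ, (x + 1 / 2 + Complex.I * u) ^ n * ((1 / Real.cosh (π * u) : ℝ) : ℂ)) - x ^ n := by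
    rw [e1, integral_sub i1 i0', integral_const_mul, aux_sech, mul_one]
  have v2 : ∫ u : ℝ, auxG n x (-(1 / 2) + u * Complex.I) =
      -((∫ u : ℝ, (x - 1 / 2 + Complex.I * u) ^ n * ((1 / Real.cosh (π * u) : ℝ) : ℂ)) - x ^ n) := by
    rw [e2, integral_neg, integral_sub i2 i0', integral_const_mul, aux_sech, mul_one]
  have t1 := intervalIntegral_tendsto_integral j1 Filter.tendsto_neg_atTop_atBot Filter.tendsto_id
  have t2 := intervalIntegral_tendsto_integral j2 Filter.tendsto_neg_atTop_atBot Filter.tendsto_id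
  have hE0 : Filter.Tendsto (fun T : ℝ => (4 * n.factorial * rexp (‖x‖ + 1)) * rexp (-T))
      Filter.atTop (nhds 0) := by
    simpa using Real.tendsto_exp_neg_atTop_nhds_zero.const_mul (4 * n.factorial * rexp (‖x‖ + 1))
  have hb : ∀ T : ℝ, 1 ≤ |T| → ‖∫ s in (-(1 / 2) : ℝ)..(1 / 2), auxG n x (s + T * Complex.I)‖ ≤
      (4 * n.factorial * rexp (‖x‖ + 1)) * rexp (-|T|) := by
    intro T hT
    have := intervalIntegral.norm_integral_le_of_norm_le_const (a := -(1 / 2)) (b := 1 / 2)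
      (f := fun s : ℝ => auxG n x (s + T * Complex.I))
      (C := (4 * n.factorial * rexp (‖x‖ + 1)) * rexp (-|T|)) (by
        intro s hs
        rw [Set.uIoc_of_le (by norm_num)] at hs
        exact auxG_bound n x s T (abs_le.2 ⟨hs.1.le, hs.2⟩) hT)
    norm_num at this ⊢
    exact this
  have t3 : Filter.Tendsto (fun T : ℝ =>
      ∫ s in (-(1 / 2) : ℝ)..(1 / 2), auxG n x (s + T * Complex.I)) Filter.atTop (nhds 0) := by
    refine squeeze_zero_norm' ?_ hE0
    filter_upwards [Filter.eventually_ge_atTop 1] with T hT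
    have := hb T (hT.trans (le_abs_self T))
    rwa [abs_of_nonneg (by linarith)] at this
  have t4 : Filter.Tendsto (fun T : ℝ =>
      ∫ s in (-(1 / 2) : ℝ)..(1 / 2), auxG n x (s + (-T : ℝ) * Complex.I))
      Filter.atTop (nhds 0) := by
    refine squeeze_zero_norm' ?_ hE0
    filter_upwards [Filter.eventually_ge_atTop 1] with T hT
    have := hb (-T) (by rw [abs_neg]; exact hT.trans (le_abs_self T))
    rwa [abs_neg, abs_of_nonneg (by linarith)] at this
  have hrect : ∀ T : ℝ, (∫ s in (-(1 / 2) : ℝ)..(1 / 2), auxG n x (s + (-T : ℝ) * Complex.I)) -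
      (∫ s in (-(1 / 2) : ℝ)..(1 / 2), auxG n x (s + T * Complex.I)) +
      Complex.I * (∫ u in (-T)..T, auxG n x (1 / 2 + u * Complex.I)) -
      Complex.I * (∫ u in (-T)..T, auxG n x (-(1 / 2) + u * Complex.I)) = 0 := by
    intro T
    have := Complex.integral_boundary_rect_eq_zero_of_differentiableOn (auxG n x)
      ⟨-(1 / 2), -T⟩ ⟨1 / 2, T⟩ ((auxG_diff n x).mono (by
        intro w hw
        have := hw.1
        simp only [Set.mem_preimage] at this
        rw [Set.uIcc_of_le (by norm_num)] at this
        exact abs_le.2 this))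
    simpa only [smul_eq_mul, Complex.ofReal_neg, Complex.ofReal_div, Complex.ofReal_one,
      Complex.ofReal_ofNat] using this
  have t5 := ((t4.sub t3).add (t1.const_mul Complex.I)).sub (t2.const_mul Complex.I)
  have t6 := tendsto_nhds_unique (t5.congr (fun T => by simpa using hrect T)) tendsto_const_nhds
  rw [v1, v2] at t6
  have t7 : Complex.I * ((∫ u : ℝ, (x + 1 / 2 + Complex.I * u) ^ n * ((1 / Real.cosh (π * u) : ℝ) : ℂ)) +
    (∫ u : ℝ, (x - 1 / 2 + Complex.I * u) ^ n * ((1 / Real.cosh (π * u) : ℝ) : ℂ)) -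
    2 * x ^ n) = 0 := by
    linear_combination t6
  have := (mul_eq_zero.1 t7).resolve_left Complex.I_ne_zero
  linear_combination this

lemma aux_series (x : ℂ) :
    (PowerSeries.mk fun m => (∫ u : ℝ, (x - 1 / 2 + Complex.I * u) ^ m *
      ((1 / Real.cosh (π * u) : ℝ) : ℂ)) / (m.factorial : ℂ)) * (PowerSeries.exp ℂ + 1) =
      2 * PowerSeries.rescale x (PowerSeries.exp ℂ) := by
  ext n
  rw [mul_add, mul_one, map_add, PowerSeries.coeff_mul, PowerSeries.coeff_mk,
    show (2 : PowerSeries ℂ) = PowerSeries.C 2 by rfl, PowerSeries.coeff_C_mul,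
    PowerSeries.coeff_rescale]
  have hs : ∫ u : ℝ, (x + 1 / 2 + Complex.I * u) ^ n * ((1 / Real.cosh (π * u) : ℝ) : ℂ) =
      ∑ p ∈ Finset.HasAntidiagonal.antidiagonal n, (n.choose p.1 : ℂ) * ∫ u : ℝ, (x - 1 / 2 + Complex.I * u) ^ p.1 *
        ((1 / Real.cosh (π * u) : ℝ) : ℂ) := by
    simp_rw [← integral_const_mul]
    rw [← integral_finsetSum _ (fun p _ => (aux_integrable p.1 (x - 1 / 2)).const_mul _)]
    congr 1
    ext u
    rw [show x + 1 / 2 + Complex.I * u = (x - 1 / 2 + Complex.I * u) + 1 by ring,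
      (Commute.all _ _).add_pow', Finset.sum_mul]
    refine Finset.sum_congr rfl fun p _ => ?_
    simp [mul_assoc]
  have hk := aux_key n x
  rw [hs] at hk
  have hn : (n.factorial : ℂ) ≠ 0 := by exact_mod_cast n.factorial_ne_zero
  have hsum : ∑ p ∈ Finset.HasAntidiagonal.antidiagonal n, (PowerSeries.coeff p.1 (PowerSeries.mk fun m =>
      (∫ u : ℝ, (x - 1 / 2 + Complex.I * u) ^ m *
      ((1 / Real.cosh (π * u) : ℝ) : ℂ)) / (m.factorial : ℂ))) *
      PowerSeries.coeff p.2 (PowerSeries.exp ℂ) =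
      (∑ p ∈ Finset.HasAntidiagonal.antidiagonal n, (n.choose p.1 : ℂ) * ∫ u : ℝ, (x - 1 / 2 + Complex.I * u) ^ p.1 *
        ((1 / Real.cosh (π * u) : ℝ) : ℂ)) / n.factorial := by
    rw [Finset.sum_div]
    refine Finset.sum_congr rfl fun p hp => ?_
    rw [Finset.HasAntidiagonal.mem_antidiagonal] at hp
    subst hp
    rw [PowerSeries.coeff_mk, PowerSeries.coeff_exp]
    have h1 : (p.1.factorial : ℂ) ≠ 0 := by exact_mod_cast p.1.factorial_ne_zero
    have h2 : (p.2.factorial : ℂ) ≠ 0 := by exact_mod_cast p.2.factorial_ne_zero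
    have h3 : (((p.1 + p.2).choose p.1 : ℕ) : ℂ) * p.1.factorial * p.2.factorial =
        (p.1 + p.2).factorial := by
      rw [Nat.choose_symm_add]
      exact_mod_cast Nat.add_choose_mul_factorial_mul_factorial p.1 p.2
    rw [← h3] at hn ⊢
    have h4 : (((p.1 + p.2).choose p.1 : ℕ) : ℂ) ≠ 0 := by
      intro h; rw [h] at hn; simp at hn
    simp only [one_div, map_inv₀, map_natCast]
    field_simp
  rw [hsum, ← add_div, hk, PowerSeries.coeff_exp]
  simp only [one_div, map_inv₀, map_natCast]
  ring

/-- Moment representation of the Euler polynomials (defined by the generating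
function `2 e^{x t}/(e^t + 1) = Σ E_n(x) tⁿ/n!`):
`E_n(x) = ∫ (x - 1/2 + i u)^n sech(π u) du`, the integral being absolutely
convergent and equal to the (real) value `E_n(x)`. -/
theorem statement_3 (n : ℕ) (x : ℝ) (E : ℕ → ℝ)
    (hE : (PowerSeries.mk fun m => E m / (m.factorial : ℝ)) * (PowerSeries.exp ℝ + 1) =
      2 * PowerSeries.rescale x (PowerSeries.exp ℝ)) :
    Integrable (fun u : ℝ =>
      ((x : ℂ) - 1 / 2 + Complex.I * (u : ℂ)) ^ n * ((1 / Real.cosh (π * u) : ℝ) : ℂ)) ∧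
    ((E n : ℝ) : ℂ) =
      ∫ u : ℝ, ((x : ℂ) - 1 / 2 + Complex.I * (u : ℂ)) ^ n *
        ((1 / Real.cosh (π * u) : ℝ) : ℂ) := by
  refine ⟨aux_integrable n ((x : ℂ) - 1 / 2), ?_⟩
  have h1 := congrArg (PowerSeries.map Complex.ofRealHom) hE
  rw [map_mul, map_mul, map_add, map_one, PowerSeries.map_exp, ← PowerSeries.rescale_map,
    PowerSeries.map_exp, map_ofNat] at h1
  have h2 := aux_series (x : ℂ)
  have hne : (PowerSeries.exp ℂ + 1) ≠ 0 := by
    intro h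
    have := congrArg (PowerSeries.coeff 1) h
    simp [PowerSeries.coeff_exp, PowerSeries.coeff_one] at this
  have h3 := mul_right_cancel₀ hne (h1.trans h2.symm)
  have h4 := congrArg (PowerSeries.coeff n) h3
  rw [PowerSeries.coeff_map, PowerSeries.coeff_mk, PowerSeries.coeff_mk] at h4
  have hn : (n.factorial : ℂ) ≠ 0 := by exact_mod_cast n.factorial_ne_zero
  simp only [Complex.ofRealHom_eq_coe, Complex.ofReal_div, Complex.ofReal_natCast] at h4
  have h5 := (div_left_inj' hn).1 h4
  rw [h5]
  simp
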